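/- arXiv:2503.02222 — 8 statements merged into one kernel-verified Lean document; each statement's English description precedes it below -/
import Mathlib

section
/- Let n, k, q be integers with q ≥ 2 and 0 ≤ k ≤ ⌊n/2⌋ − 1. Suppose there exist real numbers p_{k+1}, …, p_n with p_i ≥ 0 for all i ∈ [k+1, n−k−1], such that ∑_{i=j}^{n} p_i · C(n−j, i−j) ≤ 0 for every j ∈ [k+1, n], and ∑_{i=⌊n/2⌋+1}^{n} p_i · (q^{2i−n} − 1) · C(n, i) > 0. Then the system U(n,k,q) has no solution. -/
open Finset

/-- Feasibility of the linear system `U(n,k,q)` from the paper: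
real variables `x_{k+1}, …, x_n` with
`x_i ≥ 0` for `i ∈ [k+1, n]`;
`∑_{j=k+1}^{i} C(n−j, i−j)·x_j ≥ 0` for `i ∈ [k+1, ⌊n/2⌋]`;
`∑_{j=k+1}^{i} C(n−j, i−j)·x_j ≥ (q^{2i−n} − 1)·C(n, i)` for `i ∈ [⌊n/2⌋+1, n−k−1]`;
`∑_{j=k+1}^{i} C(n−j, i−j)·x_j = (q^{2i−n} − 1)·C(n, i)` for `i ∈ [n−k, n]`. -/
def UFeasible (n k q : ℕ) : Prop :=
  ∃ x : ℕ → ℝ,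
    (∀ i, k + 1 ≤ i → i ≤ n → 0 ≤ x i) ∧
    (∀ i, k + 1 ≤ i → i ≤ n / 2 →
      0 ≤ ∑ j ∈ Finset.Icc (k + 1) i, ((n - j).choose (i - j) : ℝ) * x j) ∧
    (∀ i, n / 2 + 1 ≤ i → i ≤ n - k - 1 →
      ((q : ℝ) ^ (2 * i - n) - 1) * (n.choose i : ℝ) ≤
        ∑ j ∈ Finset.Icc (k + 1) i, ((n - j).choose (i - j) : ℝ) * x j) ∧
    (∀ i, n - k ≤ i → i ≤ n →
      ∑ j ∈ Finset.Icc (k + 1) i, ((n - j).choose (i - j) : ℝ) * x j =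
        ((q : ℝ) ^ (2 * i - n) - 1) * (n.choose i : ℝ))

/-- Weak-duality certificate (Lemma 4): a dual solution `p` with the stated
sign, column, and objective conditions certifies infeasibility of `U(n,k,q)`. -/
theorem stmt_0 (n k q : ℕ) (hq : 2 ≤ q) (hk : k + 1 ≤ n / 2)
    (p : ℕ → ℝ)
    (hp_nonneg : ∀ i, k + 1 ≤ i → i ≤ n - k - 1 → 0 ≤ p i)
    (hp_cols : ∀ j, k + 1 ≤ j → j ≤ n →
      ∑ i ∈ Finset.Icc j n, p i * ((n - j).choose (i - j) : ℝ) ≤ 0)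
    (hp_obj : 0 < ∑ i ∈ Finset.Icc (n / 2 + 1) n,
      p i * (((q : ℝ) ^ (2 * i - n) - 1) * (n.choose i : ℝ))) :
    ¬ UFeasible n k q := by
  rintro ⟨x, hx, hlow, hmid, hhigh⟩
  set S : ℕ → ℝ := fun i =>
    ∑ j ∈ Finset.Icc (k + 1) i, ((n - j).choose (i - j) : ℝ) * x j with hS
  have hswap : ∑ i ∈ Finset.Icc (k + 1) n, p i * S i =
      ∑ j ∈ Finset.Icc (k + 1) n,
        x j * ∑ i ∈ Finset.Icc j n, p i * ((n - j).choose (i - j) : ℝ) := by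
    simp only [hS, Finset.mul_sum]
    rw [Finset.sum_comm' (t' := Finset.Icc (k + 1) n) (s' := fun j => Finset.Icc j n)]
    · refine Finset.sum_congr rfl fun j _ => Finset.sum_congr rfl fun i _ => ?_
      ring
    · intro i j
      simp only [Finset.mem_Icc]
      omega
  have hnonpos : ∑ i ∈ Finset.Icc (k + 1) n, p i * S i ≤ 0 := by
    rw [hswap]
    refine Finset.sum_nonpos fun j hj => ?_
    rw [Finset.mem_Icc] at hj
    exact mul_nonpos_of_nonneg_of_nonpos (hx j hj.1 hj.2) (hp_cols j hj.1 hj.2)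
  have hupper : ∑ i ∈ Finset.Icc (n / 2 + 1) n,
      p i * (((q : ℝ) ^ (2 * i - n) - 1) * (n.choose i : ℝ)) ≤
        ∑ i ∈ Finset.Icc (n / 2 + 1) n, p i * S i := by
    refine Finset.sum_le_sum fun i hi => ?_
    rw [Finset.mem_Icc] at hi
    by_cases h : i ≤ n - k - 1
    · exact mul_le_mul_of_nonneg_left (hmid i hi.1 h) (hp_nonneg i (by omega) h)
    · exact (congrArg (p i * ·) (hhigh i (by omega) hi.2)).ge
  have hextend : ∑ i ∈ Finset.Icc (n / 2 + 1) n, p i * S i ≤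
      ∑ i ∈ Finset.Icc (k + 1) n, p i * S i := by
    refine Finset.sum_le_sum_of_subset_of_nonneg
      (Finset.Icc_subset_Icc (by omega) le_rfl) fun i hi hni => ?_
    rw [Finset.mem_Icc] at hi hni
    exact mul_nonneg (hp_nonneg i hi.1 (by omega)) (hlow i hi.1 (by omega))
  linarith
end

section
/- Let n, k, q be integers with q ≥ 2 and 0 ≤ k ≤ ⌊n/2⌋ − 1. Set u = ⌊n/2⌋ + 1 and v = n − k. If u < v and C(n−k−1, n−v) · (q^{2u−n} − 1) · C(n, u) > C(n−k−1, n−u) · (q^{2v−n} − 1) · C(n, v), then the system U(n,k,q) has no solution. -/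
open Finset

/-- The `2 × 2` minors of Pascal's triangle are nonnegative. -/
lemma choose_mul_choose_le_choose_mul_choose {a b N M : ℕ} (hab : a ≤ b) (hNM : N ≤ M) :
    M.choose a * N.choose b ≤ M.choose b * N.choose a := by
  have h₁ : M.choose b * b.choose a = M.choose a * (M - a).choose (b - a) :=
    Nat.choose_mul hab
  have h₂ : N.choose b * b.choose a = N.choose a * (N - a).choose (b - a) :=
    Nat.choose_mul hab
  have h₃ : (N - a).choose (b - a) ≤ (M - a).choose (b - a) :=
    Nat.choose_le_choose _ (by omega)
  refine Nat.le_of_mul_le_mul_right ?_ (Nat.choose_pos hab)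
  calc M.choose a * N.choose b * b.choose a
      = M.choose a * N.choose a * (N - a).choose (b - a) := by
        rw [mul_assoc, h₂, mul_assoc]
    _ ≤ M.choose a * N.choose a * (M - a).choose (b - a) := by gcongr
    _ = M.choose b * N.choose a * b.choose a := by
        rw [mul_right_comm (M.choose b), h₁]; ring

/-- Binomially weighted partial sums of a nonnegative sequence starting at `k + 1`
can be compared at two cut-off indices. -/
lemma choose_mul_sum_choose_le {n k u v : ℕ} (huv : u ≤ v) (hvn : v ≤ n) {x : ℕ → ℝ}
    (hx : ∀ i, k + 1 ≤ i → i ≤ n → 0 ≤ x i) :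
    ((n - k - 1).choose (n - v) : ℝ) *
        ∑ j ∈ Finset.Icc (k + 1) u, ((n - j).choose (u - j) : ℝ) * x j ≤
      ((n - k - 1).choose (n - u) : ℝ) *
        ∑ j ∈ Finset.Icc (k + 1) v, ((n - j).choose (v - j) : ℝ) * x j := by
  have hsymm {i j : ℕ} (hji : j ≤ i) (hin : i ≤ n) :
      (n - j).choose (i - j) = (n - j).choose (n - i) :=
    Nat.choose_symm_of_eq_add (by omega)
  rw [Finset.mul_sum, Finset.mul_sum]
  refine (Finset.sum_le_sum (g := fun j ↦ ((n - k - 1).choose (n - u) : ℝ) *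
    (((n - j).choose (v - j) : ℝ) * x j)) fun j hj ↦ ?_).trans
      (Finset.sum_le_sum_of_subset_of_nonneg (Finset.Icc_subset_Icc_right huv) fun j hj _ ↦ ?_)
  · rw [Finset.mem_Icc] at hj
    have h := choose_mul_choose_le_choose_mul_choose
      (show n - v ≤ n - u by omega) (show n - j ≤ n - k - 1 by omega)
    rw [hsymm hj.2 (huv.trans hvn), hsymm (hj.2.trans huv) hvn, ← mul_assoc, ← mul_assoc]
    exact mul_le_mul_of_nonneg_right (mod_cast h) (hx j hj.1 (by omega))
  · rw [Finset.mem_Icc] at hj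
    have := hx j hj.1 (by omega)
    positivity

/-- Theorem 8 of the paper: with `u = ⌊n/2⌋ + 1` and `v = n − k`, if `u < v` and
`C(n−k−1, n−v)·(q^{2u−n} − 1)·C(n, u) > C(n−k−1, n−u)·(q^{2v−n} − 1)·C(n, v)`,
then the system `U(n,k,q)` has no solution. -/
theorem stmt_1 (n k q : ℕ) (hq : 2 ≤ q) (hk : k + 1 ≤ n / 2)
    (u v : ℕ) (hu : u = n / 2 + 1) (hv : v = n - k) (huv : u < v)
    (hineq :
      ((n - k - 1).choose (n - v) : ℝ) * (((q : ℝ) ^ (2 * u - n) - 1) * (n.choose u : ℝ)) >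
      ((n - k - 1).choose (n - u) : ℝ) * (((q : ℝ) ^ (2 * v - n) - 1) * (n.choose v : ℝ))) :
    ¬ UFeasible n k q := by
  rintro ⟨x, hx, -, hge, heq⟩
  have hu' := hge u hu.ge (by omega)
  have hv' := heq v hv.ge (by omega)
  have h := choose_mul_sum_choose_le huv.le (show v ≤ n by omega) hx
  rw [hv'] at h
  exact hineq.not_ge ((mul_le_mul_of_nonneg_left hu' (Nat.cast_nonneg _)).trans h)
end

section
/- For every integer l ≥ 2 there exist a constant c > 0 and an integer Q such that for all integers q ≥ Q and all integers m with 2m > c·q², both inequalities hold: (m+l)! · l! · (q² − 1) > (m+1)! · (2l−1)! · (q^{2l} − 1) and (m+l+1)! · l! · (q − 1) > (m+1)! · (2l)! · (q^{2l+1} − 1). -/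
/-- The factorial growth `(n + k)! ≥ n! (n + 1) ^ k` beats `K (q ^ (2k + j) - 1)` once `n` exceeds
`2 K q ^ 2`. -/
lemma factorial_mul_lt_factorial_add_mul {n k j q K : ℕ} (hk : k ≠ 0) (hj : j ≠ 0) (hq : 2 ≤ q)
    (hK : 0 < K) (hn : 2 * K * q ^ 2 ≤ n) :
    n.factorial * (K * (q ^ (2 * k + j) - 1)) < (n + k).factorial * (q ^ j - 1) := by
  have hqj : 2 ≤ q ^ j := hq.trans (Nat.le_self_pow hj q)
  have hpow : 2 * K * q ^ (2 * k) ≤ (n + 1) ^ k := calc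
    2 * K * q ^ (2 * k) ≤ (2 * K) ^ k * q ^ (2 * k) :=
      Nat.mul_le_mul_right _ (Nat.le_self_pow hk _)
    _ = (2 * K * q ^ 2) ^ k := by rw [mul_pow (2 * K), pow_mul]
    _ ≤ (n + 1) ^ k := Nat.pow_le_pow_left (hn.trans n.le_succ) k
  have hlt : K * (q ^ (2 * k + j) - 1) < (n + 1) ^ k * (q ^ j - 1) := calc
    K * (q ^ (2 * k + j) - 1) < K * q ^ (2 * k + j) :=
      Nat.mul_lt_mul_of_pos_left (Nat.sub_lt (by positivity) one_pos) hK
    _ = K * q ^ (2 * k) * q ^ j := by rw [pow_add, mul_assoc]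
    _ ≤ K * q ^ (2 * k) * (2 * (q ^ j - 1)) := Nat.mul_le_mul_left _ (by omega)
    _ = 2 * K * q ^ (2 * k) * (q ^ j - 1) := by ring
    _ ≤ (n + 1) ^ k * (q ^ j - 1) := Nat.mul_le_mul_right _ hpow
  calc
    n.factorial * (K * (q ^ (2 * k + j) - 1)) < n.factorial * ((n + 1) ^ k * (q ^ j - 1)) :=
      Nat.mul_lt_mul_of_pos_left hlt n.factorial_pos
    _ = n.factorial * (n + 1) ^ k * (q ^ j - 1) := (mul_assoc _ _ _).symm
    _ ≤ (n + k).factorial * (q ^ j - 1) :=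
      Nat.mul_le_mul_right _ Nat.factorial_mul_pow_le_factorial

/-- Corollary 10 of the paper at the level of the factorial inequalities of
Corollary 9: for every fixed `l ≥ 2` there are a constant `c > 0` and a
threshold `Q` such that for all `q ≥ Q` and all `m` with `2m > c·q²`, both
factorial inequalities hold. -/
theorem stmt_3 (l : ℕ) (hl : 2 ≤ l) :
    ∃ c : ℝ, 0 < c ∧ ∃ Q : ℕ, ∀ q : ℕ, Q ≤ q → ∀ m : ℕ,
      (2 * m : ℝ) > c * (q : ℝ) ^ 2 →
      ((m + l).factorial * l.factorial * (q ^ 2 - 1) >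
        (m + 1).factorial * (2 * l - 1).factorial * (q ^ (2 * l) - 1)) ∧
      ((m + l + 1).factorial * l.factorial * (q - 1) >
        (m + 1).factorial * (2 * l).factorial * (q ^ (2 * l + 1) - 1)) := by
  refine ⟨4 * (2 * l).factorial, by positivity, 2, fun q hq m hm ↦ ?_⟩
  have hm' : 2 * (2 * l).factorial * q ^ 2 ≤ m := by
    have h : ((2 * (2 * l).factorial * q ^ 2 : ℕ) : ℝ) ≤ m := by
      push_cast
      linarith
    exact_mod_cast h
  constructor
  · have hle : (2 * l - 1).factorial ≤ (2 * l).factorial := Nat.factorial_le (by omega)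
    have key := factorial_mul_lt_factorial_add_mul (n := m + 1) (k := l - 1) (j := 2)
      (K := (2 * l - 1).factorial) (by omega) two_ne_zero hq (Nat.factorial_pos _)
      ((by gcongr : 2 * (2 * l - 1).factorial * q ^ 2 ≤ 2 * (2 * l).factorial * q ^ 2).trans
        (hm'.trans m.le_succ))
    rw [show 2 * (l - 1) + 2 = 2 * l by omega, show m + 1 + (l - 1) = m + l by omega,
      ← mul_assoc] at key
    exact key.trans_le (Nat.mul_le_mul_right _ (Nat.le_mul_of_pos_right _ l.factorial_pos))
  · have key := factorial_mul_lt_factorial_add_mul (n := m + 1) (k := l) (j := 1)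
      (K := (2 * l).factorial) (by omega) one_ne_zero hq (Nat.factorial_pos _)
      (hm'.trans m.le_succ)
    rw [pow_one, show m + 1 + l = m + l + 1 by omega, ← mul_assoc] at key
    exact key.trans_le (Nat.mul_le_mul_right _ (Nat.le_mul_of_pos_right _ l.factorial_pos))
end

section
/- Let q ≥ 2 be an integer and let θ be a real number with 0 < θ < 1/2 satisfying (1/2)·ln(1 − 2θ) + (1 − θ)·ln((1 − θ)/(1 − 2θ)) + θ·ln 2 − (1 − 2θ)·ln q > 0. Then there exists N such that for every integer n ≥ N, setting k = ⌈θn⌉, u = ⌊n/2⌋ + 1 and v = n − k, one has k ≤ ⌊n/2⌋ − 1, u < v, and C(n−k−1, n−v) · (q^{2u−n} − 1) · C(n, u) > C(n−k−1, n−u) · (q^{2v−n} − 1) · C(n, v); in particular the system U(n, k, q) has no solution. -/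
open Finset

open Filter Topology

theorem choose_mul_choose_le_of_le {N M a b : ℕ} (hNM : N ≤ M) (hba : b ≤ a) :
    N.choose a * M.choose b ≤ M.choose a * N.choose b := by
  have h1 := Nat.choose_mul (n := N) hba
  have h2 := Nat.choose_mul (n := M) hba
  have h3 : (N - b).choose (a - b) ≤ (M - b).choose (a - b) :=
    Nat.choose_le_choose _ (by omega)
  refine Nat.le_of_mul_le_mul_right ?_ (Nat.choose_pos hba)
  calc N.choose a * M.choose b * a.choose b
      = N.choose a * a.choose b * M.choose b := by ring
    _ = N.choose b * M.choose b * (N - b).choose (a - b) := by rw [h1]; ring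
    _ ≤ N.choose b * M.choose b * (M - b).choose (a - b) := Nat.mul_le_mul_left _ h3
    _ = M.choose a * a.choose b * N.choose b := by rw [h2]; ring
    _ = M.choose a * N.choose b * a.choose b := by ring

/-- The binomial obstruction to feasibility, using the constraints of index `u` and `v`. -/
theorem not_uFeasible_of_choose_mul_lt {n k q u v : ℕ} (hu : n / 2 + 1 ≤ u) (huv : u < v)
    (hv : v = n - k)
    (h : ((n - k - 1).choose (n - u) : ℝ) * (((q : ℝ) ^ (2 * v - n) - 1) * (n.choose v : ℝ)) <
      ((n - k - 1).choose (n - v) : ℝ) * (((q : ℝ) ^ (2 * u - n) - 1) * (n.choose u : ℝ))) :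
    ¬ UFeasible n k q := by
  rintro ⟨x, hx, -, hge, heq⟩
  have hSu := hge u hu (by omega)
  have hSv := heq v hv.ge (by omega)
  rw [← hSv] at h
  refine absurd (h.trans_le (mul_le_mul_of_nonneg_left hSu (Nat.cast_nonneg _))) (not_lt.2 ?_)
  rw [Finset.mul_sum, Finset.mul_sum]
  refine (Finset.sum_le_sum fun j hj => ?_).trans
    (Finset.sum_le_sum_of_subset_of_nonneg (Finset.Icc_subset_Icc_right huv.le)
      fun j hj _ => ?_)
  · rw [Finset.mem_Icc] at hj
    have key := choose_mul_choose_le_of_le (N := n - j) (M := n - k - 1) (a := n - u)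
      (b := n - v) (by omega) (by omega)
    rw [← Nat.choose_symm_of_eq_add (n := n - j) (a := u - j) (b := n - u) (by omega),
      ← Nat.choose_symm_of_eq_add (n := n - j) (a := v - j) (b := n - v) (by omega)] at key
    have key' : ((n - j).choose (u - j) : ℝ) * (n - k - 1).choose (n - v) ≤
        (n - k - 1).choose (n - u) * (n - j).choose (v - j) := mod_cast key
    have := mul_le_mul_of_nonneg_right key' (hx j hj.1 (by omega))
    linarith
  · rw [Finset.mem_Icc] at hj
    have := hx j hj.1 (by omega)
    positivity

theorem choose_mul_lt_of_factorial_mul_lt {k r s w : ℕ} {X Y : ℝ} (hw : w + s = k + r)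
    (h : (r.factorial : ℝ) * (s + k + 1).factorial * Y <
      (k + r + 1).factorial * s.factorial * X) :
    ((k + r).choose w : ℝ) * (Y * ((k + (k + r + 1)).choose (k + r + 1) : ℝ)) <
      ((k + r).choose k : ℝ) * (X * ((k + (k + r + 1)).choose (s + k + 1) : ℝ)) := by
  rw [Nat.cast_choose ℝ (by omega : w ≤ k + r), Nat.cast_choose ℝ (by omega : k ≤ k + r),
    Nat.cast_choose ℝ (by omega : k + r + 1 ≤ k + (k + r + 1)),
    Nat.cast_choose ℝ (by omega : s + k + 1 ≤ k + (k + r + 1)),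
    show k + r - w = s by omega, show k + r - k = r by omega,
    show k + (k + r + 1) - (k + r + 1) = k by omega,
    show k + (k + r + 1) - (s + k + 1) = w by omega]
  have hc : (0 : ℝ) < (k + r).factorial * (k + (k + r + 1)).factorial /
      (w.factorial * s.factorial * k.factorial * r.factorial * (k + r + 1).factorial *
        (s + k + 1).factorial) := by positivity
  refine (Eq.trans_lt ?_ (mul_lt_mul_of_pos_left h hc)).trans_eq ?_ <;> field_simp

theorem log_factorial_eq_log_stirlingSeq {m : ℕ} (hm : 0 < m) :
    Real.log m.factorial = Real.log (Stirling.stirlingSeq m) + 1 / 2 * Real.log (2 * m) +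
      (m * Real.log m - m) := by
  have hm' : (0 : ℝ) < m := mod_cast hm
  obtain ⟨l, rfl⟩ := Nat.exists_eq_succ_of_ne_zero hm.ne'
  rw [Stirling.log_stirlingSeq_formula, Real.log_div hm'.ne' (Real.exp_pos 1).ne', Real.log_exp]
  ring

theorem tendsto_log_factorial_sub_div {a : ℕ → ℕ} {α : ℝ} (hα : 0 < α)
    (ha : Tendsto (fun n : ℕ => (a n : ℝ) / n) atTop (𝓝 α)) :
    Tendsto (fun n : ℕ => (Real.log (a n).factorial - a n * Real.log n) / n) atTop
      (𝓝 (α * Real.log α - α)) := by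
  have hn : Tendsto (fun n : ℕ => (n : ℝ)) atTop atTop := tendsto_natCast_atTop_atTop
  have haR : Tendsto (fun n : ℕ => (a n : ℝ)) atTop atTop := by
    refine (ha.pos_mul_atTop hα hn).congr' ?_
    filter_upwards [eventually_gt_atTop 0] with n h0
    have : (n : ℝ) ≠ 0 := by positivity
    field_simp
  have haN : Tendsto a atTop atTop := tendsto_natCast_atTop_iff.1 haR
  have hinv : Tendsto (fun n : ℕ => ((n : ℝ))⁻¹) atTop (𝓝 0) := tendsto_inv_atTop_zero.comp hn
  have h1 : Tendsto (fun n : ℕ => Real.log (Stirling.stirlingSeq (a n)) * (n : ℝ)⁻¹) atTop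
      (𝓝 0) := by
    have hpi : √Real.pi ≠ 0 := by positivity
    simpa using
      ((Stirling.tendsto_stirlingSeq_sqrt_pi.comp haN).log hpi).mul hinv
  have h2 : Tendsto (fun n : ℕ => Real.log (2 * (a n : ℝ)) / (2 * (a n : ℝ)) *
      ((a n : ℝ) / n)) atTop (𝓝 0) := by
    have hlog : Tendsto (fun x : ℝ => Real.log x / x) atTop (𝓝 0) :=
      Real.isLittleO_log_id_atTop.tendsto_div_nhds_zero
    simpa using (hlog.comp (haR.const_mul_atTop two_pos)).mul ha
  have h3 : Tendsto (fun n : ℕ => (a n : ℝ) / n * Real.log ((a n : ℝ) / n) - (a n : ℝ) / n)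
      atTop (𝓝 (α * Real.log α - α)) := (ha.mul (ha.log hα.ne')).sub ha
  have h := (h1.add h2).add h3
  simp only [zero_add] at h
  refine h.congr' ?_
  filter_upwards [eventually_gt_atTop 0, haN.eventually_gt_atTop 0] with n h0 h0a
  have hn0 : (n : ℝ) ≠ 0 := by positivity
  have ha0 : (a n : ℝ) ≠ 0 := by positivity
  rw [log_factorial_eq_log_stirlingSeq h0a, Real.log_div ha0 hn0]
  field_simp
  ring

theorem tendsto_ceil_mul_natCast_div {θ : ℝ} (hθ : 0 ≤ θ) :
    Tendsto (fun n : ℕ => (⌈θ * n⌉₊ : ℝ) / n) atTop (𝓝 θ) :=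
  (tendsto_nat_ceil_mul_div_atTop hθ).comp tendsto_natCast_atTop_atTop

theorem tendsto_natCast_half_div :
    Tendsto (fun n : ℕ => ((n / 2 : ℕ) : ℝ) / n) atTop (𝓝 (1 / 2)) := by
  have h : Tendsto (fun n : ℕ => (⌊(1 / 2 : ℝ) * n⌋₊ : ℝ) / n) atTop (𝓝 (1 / 2)) :=
    (tendsto_nat_floor_mul_div_atTop (by norm_num)).comp tendsto_natCast_atTop_atTop
  refine h.congr fun n => ?_
  rw [show (1 / 2 : ℝ) * n = n / (2 : ℕ) by push_cast; ring, Nat.floor_div_eq_div]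

theorem eventually_ceil_add_two_le_half {θ : ℝ} (hθ0 : 0 ≤ θ) (hθ1 : θ < 1 / 2) :
    ∀ᶠ n : ℕ in atTop, ⌈θ * n⌉₊ + 2 ≤ n / 2 := by
  have hinv : Tendsto (fun n : ℕ => ((n : ℝ))⁻¹) atTop (𝓝 0) :=
    tendsto_inv_atTop_zero.comp tendsto_natCast_atTop_atTop
  have h := ((tendsto_ceil_mul_natCast_div hθ0).add hinv).eventually_lt tendsto_natCast_half_div
    (by linarith)
  filter_upwards [h, eventually_gt_atTop 0] with n hn h0
  rw [inv_eq_one_div, ← add_div, div_lt_div_iff_of_pos_right (by positivity)] at hn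
  exact_mod_cast hn

theorem eventually_factorial_mul_lt {θ c : ℝ} (hθ0 : 0 < θ) (hθ1 : θ < 1 / 2) (hc : 0 < c)
    (hcond : (1 / 2) * Real.log (1 - 2 * θ)
      + (1 - θ) * Real.log ((1 - θ) / (1 - 2 * θ))
      + θ * Real.log 2 - (1 - 2 * θ) * Real.log c > 0) :
    ∀ᶠ n : ℕ in atTop, ((n - 2 * ⌈θ * n⌉₊ - 1).factorial : ℝ) * (n / 2 + 1).factorial *
        c ^ (n - 2 * ⌈θ * n⌉₊) <
      (n - ⌈θ * n⌉₊).factorial * (n / 2 - ⌈θ * n⌉₊).factorial := by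
  have hk := tendsto_ceil_mul_natCast_div hθ0.le
  have hh := tendsto_natCast_half_div
  have hinv : Tendsto (fun n : ℕ => ((n : ℝ))⁻¹) atTop (𝓝 0) :=
    tendsto_inv_atTop_zero.comp tendsto_natCast_atTop_atTop
  have hle := eventually_ceil_add_two_le_half hθ0.le hθ1
  have t1 : Tendsto (fun n : ℕ => ((n - ⌈θ * n⌉₊ : ℕ) : ℝ) / n) atTop (𝓝 (1 - θ)) := by
    refine (hk.const_sub 1).congr' ?_
    filter_upwards [hle, eventually_gt_atTop 0] with n hn h0
    rw [Nat.cast_sub (by omega)]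
    field_simp
  have t2 : Tendsto (fun n : ℕ => ((n / 2 - ⌈θ * n⌉₊ : ℕ) : ℝ) / n) atTop
      (𝓝 (1 / 2 - θ)) := by
    refine (hh.sub hk).congr' ?_
    filter_upwards [hle] with n hn
    rw [Nat.cast_sub (by omega), sub_div]
  have t3 : Tendsto (fun n : ℕ => ((n - 2 * ⌈θ * n⌉₊ : ℕ) : ℝ) / n) atTop
      (𝓝 (1 - 2 * θ)) := by
    refine ((hk.const_mul 2).const_sub 1).congr' ?_
    filter_upwards [hle, eventually_gt_atTop 0] with n hn h0
    rw [Nat.cast_sub (by omega)]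
    push_cast
    field_simp
  have t4 : Tendsto (fun n : ℕ => ((n - 2 * ⌈θ * n⌉₊ - 1 : ℕ) : ℝ) / n) atTop
      (𝓝 (1 - 2 * θ)) := by
    rw [← sub_zero (1 - 2 * θ)]
    refine (t3.sub hinv).congr' ?_
    filter_upwards [hle] with n hn
    rw [Nat.cast_sub (by omega : 1 ≤ n - 2 * ⌈θ * n⌉₊), sub_div]
    simp
  have t5 : Tendsto (fun n : ℕ => ((n / 2 + 1 : ℕ) : ℝ) / n) atTop (𝓝 (1 / 2)) := by
    rw [← add_zero (1 / 2 : ℝ)]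
    refine (hh.add hinv).congr fun n => ?_
    rw [Nat.cast_add, add_div]
    simp
  have L := (((tendsto_log_factorial_sub_div (by linarith) t1).add
    (tendsto_log_factorial_sub_div (by linarith) t2)).sub
    ((tendsto_log_factorial_sub_div (by linarith) t4).add
      (tendsto_log_factorial_sub_div (by norm_num) t5))).sub (t3.mul_const (Real.log c))
  have hlim : 0 < (1 - θ) * Real.log (1 - θ) - (1 - θ) +
      ((1 / 2 - θ) * Real.log (1 / 2 - θ) - (1 / 2 - θ)) -
      ((1 - 2 * θ) * Real.log (1 - 2 * θ) - (1 - 2 * θ) +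
        (1 / 2 * Real.log (1 / 2) - 1 / 2)) - (1 - 2 * θ) * Real.log c := by
    rw [Real.log_div (by linarith) (by linarith)] at hcond
    rw [show 1 / 2 - θ = (1 - 2 * θ) / 2 by ring, Real.log_div (by linarith) (by norm_num),
      Real.log_div one_ne_zero two_ne_zero, Real.log_one]
    linarith
  filter_upwards [L.eventually_const_lt hlim, hle, eventually_gt_atTop 0] with n hn hn2 h0
  have hn0 : (0 : ℝ) < n := by positivity
  rw [← Real.log_lt_log_iff (by positivity) (by positivity),
    Real.log_mul (by positivity) (by positivity), Real.log_mul (by positivity) (by positivity),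
    Real.log_mul (by positivity) (by positivity), Real.log_pow]
  have hsum : ((n - ⌈θ * n⌉₊ : ℕ) : ℝ) + (n / 2 - ⌈θ * n⌉₊ : ℕ) =
      (n - 2 * ⌈θ * n⌉₊ - 1 : ℕ) + (n / 2 + 1 : ℕ) := by
    norm_cast
    omega
  have hmul := mul_pos hn hn0
  have hsum' := congrArg (· * Real.log n) hsum
  simp only [add_mul] at hsum'
  simp only [sub_mul, add_mul, div_mul_cancel₀ _ hn0.ne', mul_right_comm _ (Real.log c) (n : ℝ)]
    at hmul
  linarith

/-- Theorem 11 of the paper: if `0 < θ < 1/2` satisfies the stated logarithmic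
inequality, then for all large enough `n`, taking `k = ⌈θn⌉`, `u = ⌊n/2⌋ + 1`,
`v = n − k`, we have `k ≤ ⌊n/2⌋ − 1`, `u < v`, the binomial inequality of
Theorem 8 holds, and the system `U(n,k,q)` has no solution. -/
theorem stmt_4 (q : ℕ) (hq : 2 ≤ q) (θ : ℝ) (hθ0 : 0 < θ) (hθ1 : θ < 1 / 2)
    (hcond : (1 / 2) * Real.log (1 - 2 * θ)
      + (1 - θ) * Real.log ((1 - θ) / (1 - 2 * θ))
      + θ * Real.log 2 - (1 - 2 * θ) * Real.log q > 0) :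
    ∃ N : ℕ, ∀ n : ℕ, N ≤ n → ∀ k u v : ℕ,
      k = ⌈θ * n⌉₊ → u = n / 2 + 1 → v = n - k →
      k + 1 ≤ n / 2 ∧ u < v ∧
      (((n - k - 1).choose (n - v) : ℝ) * (((q : ℝ) ^ (2 * u - n) - 1) * (n.choose u : ℝ)) >
        ((n - k - 1).choose (n - u) : ℝ) * (((q : ℝ) ^ (2 * v - n) - 1) * (n.choose v : ℝ))) ∧
      ¬ UFeasible n k q := by
  have hq1 : (1 : ℝ) ≤ q := by exact_mod_cast (by omega : 1 ≤ q)
  obtain ⟨N, hN⟩ := eventually_atTop.1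
    ((eventually_ceil_add_two_le_half hθ0.le hθ1).and
      (eventually_factorial_mul_lt hθ0 hθ1 (by linarith) hcond))
  refine ⟨N, fun n hn k u v hk hu hv => ?_⟩
  obtain ⟨hle, hfac⟩ := hN n hn
  rw [← hk] at hle hfac
  have huv : u < v := by omega
  have hX : (1 : ℝ) ≤ (q : ℝ) ^ (2 * u - n) - 1 := by
    have h2 : (2 : ℝ) ≤ q := by exact_mod_cast hq
    have := le_self_pow₀ hq1 (by omega : 2 * u - n ≠ 0)
    linarith
  have hmain : ((n - k - 1).choose (n - u) : ℝ) *
      (((q : ℝ) ^ (2 * v - n) - 1) * (n.choose v : ℝ)) <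
      ((n - k - 1).choose (n - v) : ℝ) *
        (((q : ℝ) ^ (2 * u - n) - 1) * (n.choose u : ℝ)) := by
    have h := choose_mul_lt_of_factorial_mul_lt (k := k) (r := n - 2 * k - 1) (s := n / 2 - k)
      (w := n - u) (X := (q : ℝ) ^ (2 * u - n) - 1) (Y := (q : ℝ) ^ (2 * v - n) - 1)
      (by omega) ?_
    · rwa [show k + (k + (n - 2 * k - 1) + 1) = n by omega,
        show k + (n - 2 * k - 1) + 1 = v by omega,
        show k + (n - 2 * k - 1) = n - k - 1 by omega,
        show n / 2 - k + k + 1 = u by omega, show (n - k - 1).choose k = (n - k - 1).choose (n - v)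
          by congr 1; omega] at h
    · rw [show n / 2 - k + k + 1 = n / 2 + 1 by omega,
        show k + (n - 2 * k - 1) + 1 = n - k by omega, show 2 * v - n = n - 2 * k by omega]
      calc _ ≤ ((n - 2 * k - 1).factorial : ℝ) * (n / 2 + 1).factorial * (q : ℝ) ^ (n - 2 * k) :=
            mul_le_mul_of_nonneg_left (by linarith) (by positivity)
        _ < _ := hfac
        _ ≤ _ := le_mul_of_one_le_right (by positivity) hX
  exact ⟨by omega, huv, hmain, not_uFeasible_of_choose_mul_lt hu.ge huv hv hmain⟩
end

section
/- Let q, k be integers with q ≥ 2 and k > 2q² − 1. Then there do not exist nonnegative real numbers A₁, A₂, A₃ satisfying both equations: q² · C(2k+2, k+2) = C(2k+2, k+2) + (k+1)·A₁ + A₂, and q⁴ · C(2k+2, k+3) = C(2k+2, k+3) + C(k+1, 2)·A₁ + k·A₂ + A₃. -/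
/-- Combinatorial core of Theorem 3(1) for even `n = 2k+2`: for `q ≥ 2` and
`k > 2q² − 1`, there are no nonnegative reals `A₁, A₂, A₃` satisfying
`q²·C(2k+2, k+2) = C(2k+2, k+2) + (k+1)·A₁ + A₂` and
`q⁴·C(2k+2, k+3) = C(2k+2, k+3) + C(k+1, 2)·A₁ + k·A₂ + A₃`. -/
theorem stmt_5 (q k : ℕ) (hq : 2 ≤ q) (hk : k > 2 * q ^ 2 - 1) :
    ¬ ∃ A₁ A₂ A₃ : ℝ, 0 ≤ A₁ ∧ 0 ≤ A₂ ∧ 0 ≤ A₃ ∧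
      (q : ℝ) ^ 2 * ((2 * k + 2).choose (k + 2) : ℝ) =
        ((2 * k + 2).choose (k + 2) : ℝ) + (k + 1 : ℝ) * A₁ + A₂ ∧
      (q : ℝ) ^ 4 * ((2 * k + 2).choose (k + 3) : ℝ) =
        ((2 * k + 2).choose (k + 3) : ℝ) + ((k + 1).choose 2 : ℝ) * A₁ + (k : ℝ) * A₂ + A₃ := by
  rintro ⟨A₁, A₂, A₃, -, h₂, h₃, e₁, e₂⟩
  have hkq : 2 * (q : ℝ) ^ 2 ≤ k := by
    have : 2 * q ^ 2 ≤ k := by omega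
    exact_mod_cast this
  have hs : (1 : ℝ) < (q : ℝ) ^ 2 := by
    have : 1 < q ^ 2 := by nlinarith
    exact_mod_cast this
  have hk₀ : (0 : ℝ) < k := by linarith
  have hc : (0 : ℝ) < ((2 * k + 2).choose (k + 2) : ℝ) := by
    exact_mod_cast Nat.choose_pos (show k + 2 ≤ 2 * k + 2 by omega)
  have hd : ((2 * k + 2).choose (k + 3) : ℝ) * (k + 3) = (2 * k + 2).choose (k + 2) * k := by
    have h := Nat.choose_succ_right_eq (2 * k + 2) (k + 2)
    rw [show 2 * k + 2 - (k + 2) = k by omega] at h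
    exact_mod_cast h
  have hb : ((k + 1).choose 2 : ℝ) = (k + 1) * k / 2 := by
    rw [Nat.cast_choose_two]
    push_cast
    ring
  rw [hb] at e₂
  generalize ((2 * k + 2).choose (k + 2) : ℝ) = c at *
  generalize ((2 * k + 2).choose (k + 3) : ℝ) = d at *
  -- Eliminating `A₁` between the two equations.
  have key : A₃ + k / 2 * A₂ = ((q : ℝ) ^ 2 - 1) * (((q : ℝ) ^ 2 + 1) * d - k * c / 2) := by
    linear_combination (k / 2 : ℝ) * e₁ - e₂
  have hnonneg : 0 ≤ ((q : ℝ) ^ 2 + 1) * d - k * c / 2 := by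
    refine nonneg_of_mul_nonneg_right ?_ (sub_pos.mpr hs)
    rw [← key]
    positivity
  have hprod : (((q : ℝ) ^ 2 + 1) * d - k * c / 2) * (k + 3) =
      k * c * (((q : ℝ) ^ 2 + 1) - (k + 3) / 2) := by
    linear_combination ((q : ℝ) ^ 2 + 1) * hd
  have hneg : k * c * (((q : ℝ) ^ 2 + 1) - (k + 3) / 2) < 0 :=
    mul_neg_of_pos_of_neg (mul_pos hk₀ hc) (by linarith)
  have : 0 ≤ (((q : ℝ) ^ 2 + 1) * d - k * c / 2) * (k + 3) :=
    mul_nonneg hnonneg (by positivity)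
  linarith
end

section
/- Let q, k be integers with q ≥ 2 and k > 2q² + 2q − 1. Then there do not exist nonnegative real numbers A₁, A₂, A₃ and a real number B satisfying all three equations: q^{k+1} · B = C(2k+3, k+1) + A₁; q^{k+2} · B = C(2k+3, k+2) + (k+2)·A₁ + A₂; and q³ · C(2k+3, k+3) = C(2k+3, k+3) + C(k+2, 2)·A₁ + (k+1)·A₂ + A₃. -/
/-- Combinatorial core of Theorem 3(1) for odd `n = 2k+3`: for `q ≥ 2` and
`k > 2q² + 2q − 1`, there are no nonnegative reals `A₁, A₂, A₃` and real `B`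
satisfying the three displayed equations. -/
theorem stmt_6 (q k : ℕ) (hq : 2 ≤ q) (hk : k > 2 * q ^ 2 + 2 * q - 1) :
    ¬ ∃ A₁ A₂ A₃ B : ℝ, 0 ≤ A₁ ∧ 0 ≤ A₂ ∧ 0 ≤ A₃ ∧
      (q : ℝ) ^ (k + 1) * B = ((2 * k + 3).choose (k + 1) : ℝ) + A₁ ∧
      (q : ℝ) ^ (k + 2) * B =
        ((2 * k + 3).choose (k + 2) : ℝ) + (k + 2 : ℝ) * A₁ + A₂ ∧
      (q : ℝ) ^ 3 * ((2 * k + 3).choose (k + 3) : ℝ) =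
        ((2 * k + 3).choose (k + 3) : ℝ) + ((k + 2).choose 2 : ℝ) * A₁ + (k + 1 : ℝ) * A₂ + A₃ := by
  rintro ⟨a, b, c, B, ha, hb, hc, h₁, h₂, h₃⟩
  have hmid : (2 * k + 3).choose (k + 2) = (2 * k + 3).choose (k + 1) :=
    Nat.choose_symm_of_eq_add (by omega)
  have hnext : (2 * k + 3).choose (k + 3) * (k + 3) = (2 * k + 3).choose (k + 1) * (k + 1) := by
    have h := Nat.choose_succ_right_eq (2 * k + 3) (k + 2)
    rwa [hmid, show 2 * k + 3 - (k + 2) = k + 1 by omega] at h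
  have hpos : 0 < (2 * k + 3).choose (k + 1) := Nat.choose_pos (by omega)
  have hk' : 2 * q ^ 2 + 2 * q ≤ k := by omega
  rw [hmid] at h₂
  rw [Nat.cast_choose_two] at h₃
  generalize (2 * k + 3).choose (k + 1) = m at *
  generalize (2 * k + 3).choose (k + 3) = n at *
  rify at hnext hpos hk' hq
  push_cast at h₃
  generalize (k : ℝ) = x at *
  generalize (q : ℝ) = y at *
  generalize (m : ℝ) = M at *
  generalize (n : ℝ) = N at *
  have hb' : b = (y - 1) * M - (x + 2 - y) * a := by
    have h : y ^ (k + 2) * B = y * (y ^ (k + 1) * B) := by ring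
    rw [h₂, h₁] at h
    linarith
  have hx : 0 < x := by nlinarith
  have hN : N = M * (x + 1) / (x + 3) := by
    rw [eq_div_iff (by positivity), hnext]
  have hc' : (x + 3) * c =
      (x + 1) * ((y ^ 3 - 1) * M + (x + 3) * ((x / 2 + 1 - y) * a - (y - 1) * M)) := by
    have h : c = (y ^ 3 - 1) * N - (x + 2) * (x + 1) / 2 * a - (x + 1) * b := by linarith
    rw [h, hb', hN]
    field_simp
    ring
  have hA₁ : 0 ≤ (y ^ 3 - 1) * M + (x + 3) * ((x / 2 + 1 - y) * a - (y - 1) * M) := by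
    refine nonneg_of_mul_nonneg_right (a := x + 1) ?_ (by positivity)
    rw [← hc']
    positivity
  have hd : 0 < x + 2 - y := by nlinarith
  have he : 0 ≤ x / 2 + 1 - y := by nlinarith
  have hA₂ := mul_nonneg (mul_nonneg (by positivity : 0 ≤ x + 3) he) (hb' ▸ hb)
  have hsum : 0 ≤ (y - 1) * M * ((y ^ 2 + y + 1) * (x + 2 - y) - (x + 3) * (x + 2) / 2) := by
    linear_combination hA₂ + mul_nonneg hd.le hA₁
  have hneg : (y ^ 2 + y + 1) * (x + 2 - y) - (x + 3) * (x + 2) / 2 < 0 := by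
    nlinarith [mul_nonneg (sub_nonneg.2 hk') hd.le]
  have hyM : 0 < (y - 1) * M := mul_pos (by linarith) hpos
  exact absurd hsum (not_le.2 (mul_neg_of_pos_of_neg hyM hneg))
end

section
/- Let q, k be integers with q ≥ 2 and k > 3q² − 1, and set n = 2k + 4, a₃ = (q² − 1)·C(n, k+3), a₄ = (q⁴ − 1)·C(n, k+4) − (k+1)·(q² − 1)·C(n, k+3). Then there do not exist real numbers t₁, t₂ satisfying all four inequalities: t₁ ≥ 0; q·t₂ ≥ (k+3)·t₁; t₁·(C(k+3, 2) + q²) + a₃/q^{k+1} ≥ q·t₂·(k+2); and q·t₂·C(k+2, 2) + a₄/q^{k+1} ≥ t₁·(C(k+3, 3) + q²·(k+1)). -/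
/-- Claim III.1 of the paper (even case `n = 2k+4`): for `q ≥ 2` and
`k > 3q² − 1`, with `a₃ = (q² − 1)·C(n, k+3)` and
`a₄ = (q⁴ − 1)·C(n, k+4) − (k+1)·(q² − 1)·C(n, k+3)`, there are no reals
`t₁, t₂` satisfying the four displayed inequalities. -/
theorem stmt_7 (q k : ℕ) (hq : 2 ≤ q) (hk : k > 3 * q ^ 2 - 1)
    (n : ℕ) (hn : n = 2 * k + 4) (a₃ a₄ : ℝ)
    (ha₃ : a₃ = ((q : ℝ) ^ 2 - 1) * (n.choose (k + 3) : ℝ))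
    (ha₄ : a₄ = ((q : ℝ) ^ 4 - 1) * (n.choose (k + 4) : ℝ)
      - (k + 1 : ℝ) * ((q : ℝ) ^ 2 - 1) * (n.choose (k + 3) : ℝ)) :
    ¬ ∃ t₁ t₂ : ℝ, 0 ≤ t₁ ∧
      (k + 3 : ℝ) * t₁ ≤ (q : ℝ) * t₂ ∧
      (q : ℝ) * t₂ * (k + 2 : ℝ) ≤
        t₁ * (((k + 3).choose 2 : ℝ) + (q : ℝ) ^ 2) + a₃ / (q : ℝ) ^ (k + 1) ∧
      t₁ * (((k + 3).choose 3 : ℝ) + (q : ℝ) ^ 2 * (k + 1 : ℝ)) ≤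
        (q : ℝ) * t₂ * ((k + 2).choose 2 : ℝ) + a₄ / (q : ℝ) ^ (k + 1) := by
  rintro ⟨t₁, t₂, ht, h₂, h₃, h₄⟩
  have hQ : (4 : ℝ) ≤ (q : ℝ) ^ 2 := by
    have : (2 : ℝ) ≤ q := by exact_mod_cast hq
    nlinarith
  have hkQ : 3 * (q : ℝ) ^ 2 ≤ k := by
    have : 3 * q ^ 2 ≤ k := by omega
    exact_mod_cast this
  have hratio : (n.choose (k + 4) : ℝ) * (k + 4) = n.choose (k + 3) * (k + 1) := by
    have h := Nat.choose_succ_right_eq n (k + 3)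
    rw [show n - (k + 3) = k + 1 by omega] at h
    exact_mod_cast h
  have hpos : (0 : ℝ) < n.choose (k + 4) := by
    exact_mod_cast Nat.choose_pos (by omega : k + 4 ≤ n)
  have hqk : (0 : ℝ) < (q : ℝ) ^ (k + 1) := by positivity
  -- The fourth coefficient is too negative compared with the third.
  have hkey : a₄ + 2 / 3 * (k + 1) * a₃ < 0 := by
    have h : a₄ + 2 / 3 * (k + 1) * a₃
        = ((q : ℝ) ^ 2 - 1) * n.choose (k + 4) * ((q : ℝ) ^ 2 + 1 - (k + 4) / 3) := by
      rw [ha₃, ha₄]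
      linear_combination ((q : ℝ) ^ 2 - 1) / 3 * hratio
    rw [h]
    exact mul_neg_of_pos_of_neg (mul_pos (by linarith) hpos) (by linarith)
  have hkey' : a₄ / (q : ℝ) ^ (k + 1) + 2 / 3 * (k + 1) * (a₃ / (q : ℝ) ^ (k + 1)) < 0 := by
    have h := div_neg_of_neg_of_pos hkey hqk
    rwa [add_div, mul_div_assoc] at h
  have hc3 : ((k + 3).choose 3 : ℝ) = (k + 3) * (k + 2) * (k + 1) / 6 := by
    rw [Nat.cast_choose_eq_descPochhammer_div]
    simp [descPochhammer_succ_right, Nat.factorial]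
    ring
  rw [Nat.cast_choose_two] at h₃ h₄
  rw [hc3] at h₄
  push_cast at h₃ h₄
  generalize a₃ / (q : ℝ) ^ (k + 1) = A₃ at *
  generalize a₄ / (q : ℝ) ^ (k + 1) = A₄ at *
  generalize (q : ℝ) * t₂ = s at *
  have hk0 : (0 : ℝ) ≤ k := k.cast_nonneg
  have e₂ := mul_le_mul_of_nonneg_right h₂ (by positivity : (0 : ℝ) ≤ (k + 2) * (k + 1) / 6)
  have e₃ := mul_le_mul_of_nonneg_right h₃ (by positivity : (0 : ℝ) ≤ 2 * (k + 1) / 3)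
  have e₁ : 0 ≤ t₁ * (q : ℝ) ^ 2 * (k + 1) := by positivity
  nlinarith
end

section
/- Let q be a nonzero real number, n a natural number, N = ⌊n/2⌋, and c₀, c₁, …, c_N real numbers. Define A(x, y) = ∑_{i=0}^{N} cᵢ · (x + (q−1)y)^{n−2i} · (y(x−y))^{i}. Then for all real numbers x, y: A(((q−1)x + (q+1)y)/q, (y−x)/q) = ∑_{i=0}^{N} (−1)^{i} · cᵢ · 2^{n−2i} · q^{−i} · y^{n−2i} · (x² − y²)^{i}. -/
open Finset

/-- Eq. (40) of the paper: substituting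
`x ↦ ((q−1)x+(q+1)y)/q`, `y ↦ (y−x)/q` into the Gleason-type expansion
`A(x,y) = ∑ cᵢ (x+(q−1)y)^{n−2i} (y(x−y))^i` yields
`∑ (−1)^i cᵢ 2^{n−2i} q^{−i} y^{n−2i} (x²−y²)^i`. -/
theorem stmt_15 (q : ℝ) (hq : q ≠ 0) (n : ℕ) (c : ℕ → ℝ)
    (A : ℝ → ℝ → ℝ)
    (hA : ∀ x y : ℝ, A x y =
      ∑ i ∈ Finset.range (n / 2 + 1),
        c i * (x + (q - 1) * y) ^ (n - 2 * i) * (y * (x - y)) ^ i) :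
    ∀ x y : ℝ,
      A (((q - 1) * x + (q + 1) * y) / q) ((y - x) / q) =
        ∑ i ∈ Finset.range (n / 2 + 1),
          (-1 : ℝ) ^ i * c i * 2 ^ (n - 2 * i) * (q ^ i)⁻¹ *
            y ^ (n - 2 * i) * (x ^ 2 - y ^ 2) ^ i := by
  intro x y
  have h₁ : ((q - 1) * x + (q + 1) * y) / q + (q - 1) * ((y - x) / q) = 2 * y := by
    field_simp
    ring
  have h₂ : (y - x) / q * (((q - 1) * x + (q + 1) * y) / q - (y - x) / q) =
      -1 * q⁻¹ * (x ^ 2 - y ^ 2) := by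
    field_simp
    ring
  rw [hA]
  refine Finset.sum_congr rfl fun i _ => ?_
  rw [h₁, h₂, mul_pow, mul_pow, mul_pow, inv_pow]
  ring
end
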